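/- arXiv:2011.00974 — 2 statements merged into one kernel-verified Lean document; each statement's English description precedes it below -/
import Mathlib

section
/- Let m be a natural number, let b ∈ {1, …, 7}, and set n = 8m + b. Let (r_j)_{j≥1} be nonnegative integers, all but finitely many equal to zero, such that r_1 is divisible by 4 and r_2 is divisible by 2, and suppose there is a natural number ℓ with ℓ ≤ α(m) + b, ∑_{j≥1} r_j(2^j − 1) = n − ℓ, and ∑_{j≥1} r_j ≤ ℓ. Then ℓ = α(m) + b and r_j = ε_j(8m) for every j ≥ 1. -/
/-- `alpha n` is the number of 1's in the binary expansion of `n`. -/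
def alpha (n : ℕ) : ℕ := (Nat.digits 2 n).sum

/-- `eps N j` is the coefficient of `2^j` in the binary expansion of `N`. -/
def eps (N j : ℕ) : ℕ := N / 2 ^ j % 2

theorem alpha_rec (n : ℕ) : alpha n = n % 2 + alpha (n / 2) := by
  unfold alpha
  rcases Nat.eq_zero_or_pos n with h | h
  · subst h; simp
  · rw [Nat.digits_def' (by norm_num) h]; simp

theorem alpha_succ (n : ℕ) : alpha (n + 1) ≤ alpha n + 1 := by
  induction n using Nat.strong_induction_on with
  | _ n ih =>
    rw [alpha_rec (n + 1), alpha_rec n]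
    rcases Nat.mod_two_eq_zero_or_one n with h | h
    · have h1 : (n + 1) / 2 = n / 2 := by omega
      rw [h1]; omega
    · have h1 : (n + 1) / 2 = n / 2 + 1 := by omega
      have := ih (n / 2) (by omega)
      rw [h1]; omega

theorem alpha_add_le (n t : ℕ) : alpha (n + t) ≤ alpha n + t := by
  induction t with
  | zero => simp
  | succ t ih =>
    have := alpha_succ (n + t)
    rw [← add_assoc]; omega

theorem alpha_eight (n : ℕ) : alpha (8 * n) = alpha n := by
  rw [alpha_rec (8 * n), alpha_rec (8 * n / 2), alpha_rec (8 * n / 2 / 2)]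
  have h : 8 * n / 2 / 2 / 2 = n := by omega
  rw [h]; omega

theorem eps_succ (N j : ℕ) : eps N (j + 1) = eps (N / 2) j := by
  unfold eps
  rw [pow_succ', Nat.div_div_eq_div_mul]

theorem key (K : ℕ) : ∀ r : ℕ → ℕ,
    alpha (∑ j ∈ Finset.range K, r j * 2 ^ j) ≤ ∑ j ∈ Finset.range K, r j ∧
    (∑ j ∈ Finset.range K, r j ≤ alpha (∑ j ∈ Finset.range K, r j * 2 ^ j) →
      ∀ j < K, r j = eps (∑ j ∈ Finset.range K, r j * 2 ^ j) j) := by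
  induction K with
  | zero => intro r; simp [alpha]
  | succ K ih =>
    intro r
    have hs : ∑ j ∈ Finset.range (K + 1), r j * 2 ^ j
        = 2 * (∑ j ∈ Finset.range K, r (j + 1) * 2 ^ j) + r 0 := by
      rw [Finset.sum_range_succ', Finset.mul_sum]
      simp only [pow_zero, mul_one]
      congr 1
      apply Finset.sum_congr rfl
      intro j _
      ring
    obtain ⟨h1, h2⟩ := ih (fun j => r (j + 1))
    rw [hs, Finset.sum_range_succ']
    generalize (∑ j ∈ Finset.range K, r (j + 1) * 2 ^ j) = N at *
    generalize (∑ j ∈ Finset.range K, r (j + 1)) = k at *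
    have hr := alpha_rec (2 * N + r 0)
    have hd : (2 * N + r 0) / 2 = N + r 0 / 2 := by omega
    rw [hd] at hr
    have ha := alpha_add_le N (r 0 / 2)
    refine ⟨by omega, fun h => ?_⟩
    have hr0 : r 0 ≤ 1 := by omega
    have hz : r 0 / 2 = 0 := by omega
    rw [hz, add_zero] at hr
    intro j hj
    cases j with
    | zero => simp only [eps, pow_zero, Nat.div_one]; omega
    | succ j =>
      rw [eps_succ, hd, hz, add_zero]
      exact h2 (by omega) j (by omega)

theorem stmt9 (m b : ℕ) (hb1 : 1 ≤ b) (hb7 : b ≤ 7)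
    (r : ℕ → ℕ) (hr0 : r 0 = 0) (hfin : (Function.support r).Finite)
    (hr1 : 4 ∣ r 1) (hr2 : 2 ∣ r 2)
    (ℓ : ℕ) (hℓ : ℓ ≤ alpha m + b)
    (hsum : ∑ᶠ j, r j * (2 ^ j - 1) = 8 * m + b - ℓ)
    (hcard : ∑ᶠ j, r j ≤ ℓ) :
    ℓ = alpha m + b ∧ ∀ j, 1 ≤ j → r j = eps (8 * m) j := by
  obtain ⟨B, hB⟩ := hfin.bddAbove
  have hbig : ∀ j, B < j → r j = 0 := by
    intro j hj
    by_contra h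
    exact absurd (hB h) (by omega)
  -- work up to an arbitrary cutoff
  have main : ∀ K, B < K → ℓ = alpha m + b ∧ ∀ j < K, r j = eps (8 * m) j := by
    intro K hK
    rw [finsum_eq_sum_of_support_subset (s := Finset.range K) _ (by
      intro j hj
      have : r j ≠ 0 := fun h => hj (by simp [h])
      have := hB this
      simp; omega)] at hsum
    rw [finsum_eq_sum_of_support_subset (s := Finset.range K) _ (by
      intro j hj
      have := hB hj
      simp; omega)] at hcard
    have hadd : ∑ j ∈ Finset.range K, r j * 2 ^ j
        = ∑ j ∈ Finset.range K, r j * (2 ^ j - 1) + ∑ j ∈ Finset.range K, r j := by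
      rw [← Finset.sum_add_distrib]
      apply Finset.sum_congr rfl
      intro j _
      obtain ⟨c, hc⟩ : ∃ c, 2 ^ j = c + 1 := ⟨2 ^ j - 1, by have := Nat.one_le_two_pow (n := j); omega⟩
      rw [hc, Nat.add_sub_cancel]; ring
    have h8 : 8 ∣ ∑ j ∈ Finset.range K, r j * 2 ^ j := by
      apply Finset.dvd_sum
      intro j _
      match j with
      | 0 => simp [hr0]
      | 1 => omega
      | 2 => omega
      | j + 3 => exact Dvd.intro (r (j + 3) * 2 ^ j) (by ring)
    obtain ⟨k1, k2⟩ := key K r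
    have hm : alpha m ≤ m := by
      have := alpha_add_le 0 m
      simpa [alpha] using this
    obtain ⟨M, hM⟩ := h8
    rw [hM] at hadd k1 k2
    rw [alpha_eight] at k1 k2
    rw [hsum] at hadd
    generalize (∑ j ∈ Finset.range K, r j) = k at *
    obtain ⟨t, rfl⟩ : ∃ t, m = M + t := ⟨m - M, by omega⟩
    have := alpha_add_le M t
    have ht : t = 0 := by omega
    subst ht
    simp only [add_zero] at *
    exact ⟨by omega, k2 (by omega)⟩
  exact ⟨(main (B + 1) (by omega)).1, fun j _ => (main (B + j + 1) (by omega)).2 j (by omega)⟩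
end

section
/- Let m be a natural number, let b ∈ {1, 2, 3}, and set n = 4m + b. Let (r_j)_{j≥1} be nonnegative integers, all but finitely many equal to zero, such that r_1 is even, and suppose there is a natural number ℓ with ℓ ≤ α(m) + b, ∑_{j≥1} r_j(2^j − 1) = n − ℓ, and ∑_{j≥1} r_j ≤ ℓ. Then ℓ = α(m) + b and r_j = ε_j(4m) for every j ≥ 1. -/
theorem alpha_rec_s10 (e q : ℕ) (he : e < 2) : alpha (e + 2 * q) = e + alpha q := by
  unfold alpha
  by_cases h : e = 0 ∧ q = 0
  · obtain ⟨rfl, rfl⟩ := h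
    simp
  · rw [Nat.digits_add 2 (by norm_num) e q he (by omega)]
    simp

theorem alpha_le_self (c : ℕ) : alpha c ≤ c ∧ (c ≤ alpha c → c ≤ 1) := by
  induction c using Nat.strong_induction_on with
  | _ c ih =>
    by_cases h : c ≤ 1
    · interval_cases c <;> simp [alpha]
    · have h1 := alpha_rec_s10 (c % 2) (c / 2) (by omega)
      rw [show c % 2 + 2 * (c / 2) = c by omega] at h1
      have h2 := (ih (c / 2) (by omega)).1
      omega

theorem alpha_key (N : ℕ) : ∀ (f : ℕ → ℕ) (c : ℕ), (∀ j, N ≤ j → f j = 0) →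
    alpha (c + ∑ j ∈ Finset.range N, f j * 2 ^ j) ≤ c + ∑ j ∈ Finset.range N, f j ∧
    (c + ∑ j ∈ Finset.range N, f j ≤ alpha (c + ∑ j ∈ Finset.range N, f j * 2 ^ j) →
      c + f 0 = eps (c + ∑ j ∈ Finset.range N, f j * 2 ^ j) 0 ∧
      ∀ j, 1 ≤ j → f j = eps (c + ∑ j ∈ Finset.range N, f j * 2 ^ j) j) := by
  induction N with
  | zero =>
    intro f c hf
    simp only [Finset.range_zero, Finset.sum_empty, add_zero]
    refine ⟨(alpha_le_self c).1, fun h => ?_⟩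
    have hc := (alpha_le_self c).2 h
    refine ⟨by rw [hf 0 le_rfl]; unfold eps; simp; omega, fun j hj => ?_⟩
    rw [hf j (Nat.zero_le _)]
    unfold eps
    have : 1 < 2 ^ j := Nat.one_lt_two_pow (by omega)
    rw [Nat.div_eq_of_lt (by omega)]
  | succ N ih =>
    intro f c hf
    obtain ⟨h1, h2⟩ := ih (fun j => f (j + 1)) ((c + f 0) / 2) (fun j hj => hf _ (by omega))
    have hs : ∑ j ∈ Finset.range N, f (j + 1) * 2 ^ (j + 1)
        = 2 * ∑ j ∈ Finset.range N, f (j + 1) * 2 ^ j := by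
      rw [Finset.mul_sum]
      exact Finset.sum_congr rfl fun j _ => by ring
    rw [Finset.sum_range_succ', Finset.sum_range_succ', hs]
    simp only [pow_zero, mul_one] at *
    generalize ∑ j ∈ Finset.range N, f (j + 1) * 2 ^ j = A at *
    generalize ∑ j ∈ Finset.range N, f (j + 1) = B at *
    have hr := alpha_rec_s10 ((c + f 0) % 2) ((c + f 0) / 2 + A) (by omega)
    have hM : (c + f 0) % 2 + 2 * ((c + f 0) / 2 + A) = c + (2 * A + f 0) := by omega
    rw [hM] at hr
    refine ⟨by omega, fun h => ?_⟩
    have hq : (c + f 0) / 2 = 0 := by omega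
    obtain ⟨h3, h4⟩ := h2 (by omega)
    refine ⟨by simp [eps]; omega, fun j hj => ?_⟩
    have he : ∀ i, eps (c + (2 * A + f 0)) (i + 1) = eps ((c + f 0) / 2 + A) i := by
      intro i
      unfold eps
      rw [pow_succ', ← Nat.div_div_eq_div_mul]
      congr 2
      omega
    obtain ⟨i, rfl⟩ : ∃ i, j = i + 1 := ⟨j - 1, by omega⟩
    rw [he]
    rcases Nat.eq_zero_or_pos i with rfl | hi
    · rw [← h3, hq]; simp
    · exact h4 i hi

theorem stmt10 (m b : ℕ) (hb1 : 1 ≤ b) (hb3 : b ≤ 3)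
    (r : ℕ → ℕ) (hr0 : r 0 = 0) (hfin : (Function.support r).Finite)
    (hr1 : 2 ∣ r 1)
    (ℓ : ℕ) (hℓ : ℓ ≤ alpha m + b)
    (hsum : ∑ᶠ j, r j * (2 ^ j - 1) = 4 * m + b - ℓ)
    (hcard : ∑ᶠ j, r j ≤ ℓ) :
    ℓ = alpha m + b ∧ ∀ j, 1 ≤ j → r j = eps (4 * m) j := by
  obtain ⟨N, hN⟩ := hfin.bddAbove
  have hz : ∀ j, N < j → r j = 0 := by
    intro j hj
    by_contra h
    have := hN (show j ∈ Function.support r from h)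
    omega
  have hsub : Function.support r ⊆ ↑(Finset.range (N + 1 + 1)) := by
    intro j hj
    have := hN hj
    simp
    omega
  rw [finsum_eq_sum_of_support_subset _ hsub] at hcard
  rw [finsum_eq_sum_of_support_subset (s := Finset.range (N + 1 + 1)) _
    (fun j hj => hsub (fun h => hj (by simp [h])))] at hsum
  have hadd : ∑ j ∈ Finset.range (N + 1 + 1), r j * (2 ^ j - 1)
      + ∑ j ∈ Finset.range (N + 1 + 1), r j = ∑ j ∈ Finset.range (N + 1 + 1), r j * 2 ^ j := by
    rw [← Finset.sum_add_distrib]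
    refine Finset.sum_congr rfl fun j _ => ?_
    obtain ⟨t, ht⟩ : ∃ t, 2 ^ j = t + 1 := ⟨2 ^ j - 1, by have := Nat.one_le_two_pow (n := j); omega⟩
    rw [ht]
    simp
    ring
  rw [hsum] at hadd
  have hs : ∑ j ∈ Finset.range N, r (j + 1 + 1) * 2 ^ (j + 1 + 1)
      = 4 * ∑ j ∈ Finset.range N, r (j + 1 + 1) * 2 ^ j := by
    rw [Finset.mul_sum]
    exact Finset.sum_congr rfl fun j _ => by ring
  rw [Finset.sum_range_succ', Finset.sum_range_succ'] at hcard
  rw [Finset.sum_range_succ', Finset.sum_range_succ', Finset.sum_range_succ',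
    Finset.sum_range_succ', hs] at hadd
  simp only [hr0, zero_add, pow_one, zero_mul, add_zero] at hadd hcard
  have ham := (alpha_le_self m).1
  have key := alpha_key N (fun j => r (j + 1 + 1))
    (m - ∑ j ∈ Finset.range N, r (j + 1 + 1) * 2 ^ j) (fun j hj => hz _ (by omega))
  generalize ∑ j ∈ Finset.range N, r (j + 1 + 1) * 2 ^ j = A at *
  generalize ∑ j ∈ Finset.range N, r (j + 1 + 1) = B at *
  obtain ⟨t, ht⟩ := hr1
  have hA : A ≤ m := by omega
  rw [Nat.sub_add_cancel hA] at key
  obtain ⟨k1, k2⟩ := key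
  have hc : m - A = 0 := by omega
  obtain ⟨k3, k4⟩ := k2 (by omega)
  refine ⟨by omega, fun j hj => ?_⟩
  have he : ∀ i, eps (4 * m) (i + 1 + 1) = eps m i := by
    intro i
    unfold eps
    rw [pow_succ', pow_succ', ← Nat.div_div_eq_div_mul, ← Nat.div_div_eq_div_mul]
    congr 2
    omega
  obtain rfl | ⟨i, rfl⟩ : j = 1 ∨ ∃ i, j = i + 1 + 1 := by
    by_cases h : j = 1
    · exact Or.inl h
    · exact Or.inr ⟨j - 2, by omega⟩
  · have : r 1 = 0 := by omega
    rw [this]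
    simp [eps]
    omega
  · rw [he]
    rcases Nat.eq_zero_or_pos i with rfl | hi
    · rw [← k3, hc]; simp
    · exact k4 i hi
end
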